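/- The graph Γ_ℂ(X³Y³, X⁶Y⁶) has girth four; in particular, it contains a 4-cycle with first coordinates a = 1, b = −1/2 + (√3/2)i in one partite set and x = 1, y = −1 in the other. -/

import Mathlib

/-- The algebraically defined bipartite graph `Γ_R(f₂, f₃)`: the first summand consists of
points `(a₁,a₂,a₃)`, the second of lines `[x₁,x₂,x₃]`; a point is adjacent to a line iff
`a₂ + x₂ = f₂ (a₁, x₁)` and `a₃ + x₃ = f₃ (a₁, x₁)`. -/
def adGraph (R : Type*) [CommRing R] (f₂ f₃ : R × R → R) :
    SimpleGraph ((R × R × R) ⊕ (R × R × R)) :=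
  SimpleGraph.fromRel (fun u v =>
    ∃ a x : R × R × R, u = Sum.inl a ∧ v = Sum.inr x ∧
      a.2.1 + x.2.1 = f₂ (a.1, x.1) ∧ a.2.2 + x.2.2 = f₃ (a.1, x.1))

/-- The complex monomial graph `Γ_ℂ(X³Y³, X⁶Y⁶)`. -/
noncomputable def G : SimpleGraph ((ℂ × ℂ × ℂ) ⊕ (ℂ × ℂ × ℂ)) :=
  adGraph ℂ (fun p => p.1 ^ 3 * p.2 ^ 3) (fun p => p.1 ^ 6 * p.2 ^ 6)

theorem adGraph_adj_inl_inr {R : Type*} [CommRing R] (f₂ f₃ : R × R → R) (a x : R × R × R) :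
    (adGraph R f₂ f₃).Adj (Sum.inl a) (Sum.inr x) ↔
      a.2.1 + x.2.1 = f₂ (a.1, x.1) ∧ a.2.2 + x.2.2 = f₃ (a.1, x.1) := by
  rw [adGraph, SimpleGraph.fromRel_adj]
  constructor
  · rintro ⟨-, ⟨_, _, ⟨⟩, ⟨⟩, h⟩ | ⟨_, _, ⟨⟩, -⟩⟩
    exact h
  · exact fun h => ⟨Sum.inl_ne_inr, .inl ⟨a, x, rfl, rfl, h⟩⟩

/-- The proper two-colouring of `adGraph` that separates points from lines. -/
def adGraphColoring (R : Type*) [CommRing R] (f₂ f₃ : R × R → R) :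
    (adGraph R f₂ f₃).Coloring Bool :=
  SimpleGraph.Coloring.mk Sum.isLeft (by
    rintro u v h
    rw [adGraph, SimpleGraph.fromRel_adj] at h
    obtain ⟨-, ⟨a, x, rfl, rfl, -⟩ | ⟨a, x, rfl, rfl, -⟩⟩ := h <;> simp)

theorem four_le_egirth_adGraph {R : Type*} [CommRing R] (f₂ f₃ : R × R → R) :
    4 ≤ (adGraph R f₂ f₃).egirth := by
  rw [SimpleGraph.le_egirth]
  intro u w hw
  have h_even : Even w.length :=
    ((adGraphColoring R f₂ f₃).even_length_iff_congr w).2 Iff.rfl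
  have h_three := hw.three_le_length
  have h_four : 4 ≤ w.length := by
    obtain ⟨k, hk⟩ := h_even
    omega
  exact_mod_cast h_four

theorem egirth_le_four_of_adj {V : Type*} {H : SimpleGraph V} {a b c d : V}
    (hab : H.Adj a b) (hbc : H.Adj b c) (hcd : H.Adj c d) (hda : H.Adj d a)
    (hac : a ≠ c) (hbd : b ≠ d) : H.egirth ≤ 4 := by
  let w : H.Walk a a := .cons hab (.cons hbc (.cons hcd (.cons hda .nil)))
  have hw : w.IsCycle := by
    simp [w, SimpleGraph.Walk.cons_isCycle_iff, SimpleGraph.Walk.isPath_def, hab.ne, hab.ne', hbc.ne,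
      hcd.ne, hda.ne, hda.ne', hac, hac.symm, hbd]
  exact SimpleGraph.egirth_le_length hw

theorem primitive_cube_root_pow_three :
    (-(1 / 2) + ((Real.sqrt 3 / 2 : ℝ) : ℂ) * Complex.I) ^ 3 = 1 := by
  have h : ((Real.sqrt 3 : ℝ) : ℂ) ^ 2 = 3 := by
    rw [← Complex.ofReal_pow, Real.sq_sqrt (by norm_num)]
    norm_num
  push_cast
  linear_combination
    (-3 / 8 * Complex.I ^ 2 + ((Real.sqrt 3 : ℝ) : ℂ) / 8 * Complex.I ^ 3) * h +
    (-9 / 8 + 3 / 8 * ((Real.sqrt 3 : ℝ) : ℂ) * Complex.I) * Complex.I_sq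

theorem complex_girth_four :
    G.egirth = 4 ∧
      ∃ p p' l l' : ℂ × ℂ × ℂ,
        p.1 = 1 ∧ p'.1 = -(1 / 2) + ((Real.sqrt 3 / 2 : ℝ) : ℂ) * Complex.I ∧
        l.1 = 1 ∧ l'.1 = -1 ∧
        G.Adj (Sum.inl p) (Sum.inr l) ∧ G.Adj (Sum.inr l) (Sum.inl p') ∧
        G.Adj (Sum.inl p') (Sum.inr l') ∧ G.Adj (Sum.inr l') (Sum.inl p) := by
  set ζ : ℂ := -(1 / 2) + ((Real.sqrt 3 / 2 : ℝ) : ℂ) * Complex.I with hζ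
  have h_cube : ζ ^ 3 = 1 := primitive_cube_root_pow_three
  have h_sixth : ζ ^ 6 = 1 := by linear_combination (ζ ^ 3 + 1) * h_cube
  have h_ne : (1 : ℂ) ≠ ζ := by
    intro h
    have h_re := congrArg Complex.re h
    norm_num [hζ] at h_re
  have h₁ : G.Adj (Sum.inl (1, 0, 0)) (Sum.inr (1, 1, 1)) := by
    simp [G, adGraph_adj_inl_inr]
  have h₂ : G.Adj (Sum.inl (ζ, 0, 0)) (Sum.inr (1, 1, 1)) := by
    simp [G, adGraph_adj_inl_inr, h_cube, h_sixth]
  have h₃ : G.Adj (Sum.inl (ζ, 0, 0)) (Sum.inr (-1, -1, 1)) := by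
    norm_num [G, adGraph_adj_inl_inr, h_cube, h_sixth]
  have h₄ : G.Adj (Sum.inl (1, 0, 0)) (Sum.inr (-1, -1, 1)) := by
    norm_num [G, adGraph_adj_inl_inr]
  refine ⟨le_antisymm ?_ (four_le_egirth_adGraph _ _),
    (1, 0, 0), (ζ, 0, 0), (1, 1, 1), (-1, -1, 1), rfl, rfl, rfl, rfl, h₁, h₂.symm, h₃, h₄.symm⟩
  refine egirth_le_four_of_adj h₁ h₂.symm h₃ h₄.symm (by simpa using h_ne) ?_
  norm_num [Prod.ext_iff]
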